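/- Suppose A is generated by two axes a and b of Jordan type (λ,δ) and (λ',δ') respectively. Then A is spanned as an F-vector space by a, b, and a·b; in particular dim_F A ≤ 3. -/

import Mathlib

/-! Common definitions: eigenspaces of left/right multiplication, axes, Jordan axes,
in a not-necessarily-associative, not-necessarily-commutative, not-necessarily-unital
algebra `A` over a field `F`. -/

variable (F : Type*) [Field F]
variable (A : Type*) [NonUnitalNonAssocRing A] [Module F A]
  [SMulCommClass F A A] [IsScalarTower F A A]

/-- `leftEig F A a l = A_l(L_a) = {v : A | a * v = l • v}`, as a submodule of `A`. -/
def leftEig (a : A) (l : F) : Submodule F A where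
  carrier := {v | a * v = l • v}
  add_mem' := by
    intro x y hx hy
    simp only [Set.mem_setOf_eq] at *
    rw [mul_add, hx, hy, smul_add]
  zero_mem' := by simp
  smul_mem' := by
    intro c x hx
    simp only [Set.mem_setOf_eq] at *
    rw [mul_smul_comm, hx, smul_comm]

/-- `rightEig F A a l = A_l(R_a) = {v : A | v * a = l • v}`, as a submodule of `A`. -/
def rightEig (a : A) (l : F) : Submodule F A where
  carrier := {v | v * a = l • v}
  add_mem' := by
    intro x y hx hy
    simp only [Set.mem_setOf_eq] at *
    rw [add_mul, hx, hy, smul_add]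
  zero_mem' := by simp
  smul_mem' := by
    intro c x hx
    simp only [Set.mem_setOf_eq] at *
    rw [smul_mul_assoc, hx, smul_comm]

/-- `eig2 F A a l d = A_{l,d}(a) = A_l(L_a) ⊓ A_d(R_a)`. -/
def eig2 (a : A) (l d : F) : Submodule F A :=
  leftEig F A a l ⊓ rightEig F A a d

/-- `a` is a left axis of type `l` (with `l ∉ {0,1}`):  an absolutely primitive idempotent
whose left multiplication operator satisfies `(L_a - l)(L_a - 1)L_a = 0`, such that the
eigenspace decomposition `A = A_0(L_a) ⊕ A_1(L_a) ⊕ A_l(L_a)` is a ℤ/2-grading with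
plus part `A_0(L_a) ⊕ A_1(L_a)` and minus part `A_l(L_a)`. -/
structure IsLeftAxis (l : F) (a : A) : Prop where
  l_ne_zero : l ≠ 0
  l_ne_one : l ≠ 1
  idem : a * a = a
  prim : leftEig F A a 1 = Submodule.span F {a}
  cube : ∀ v : A, a * (a * (a * v)) - a * (a * v) - l • (a * (a * v)) + l • (a * v) = 0
  decomp : leftEig F A a 0 ⊔ leftEig F A a 1 ⊔ leftEig F A a l = ⊤
  fusePP : ∀ x ∈ leftEig F A a 0 ⊔ leftEig F A a 1, ∀ y ∈ leftEig F A a 0 ⊔ leftEig F A a 1,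
      x * y ∈ leftEig F A a 0 ⊔ leftEig F A a 1
  fusePM : ∀ x ∈ leftEig F A a 0 ⊔ leftEig F A a 1, ∀ y ∈ leftEig F A a l,
      x * y ∈ leftEig F A a l
  fuseMP : ∀ x ∈ leftEig F A a l, ∀ y ∈ leftEig F A a 0 ⊔ leftEig F A a 1,
      x * y ∈ leftEig F A a l
  fuseMM : ∀ x ∈ leftEig F A a l, ∀ y ∈ leftEig F A a l,
      x * y ∈ leftEig F A a 0 ⊔ leftEig F A a 1

/-- `a` is a right axis of type `d`: the symmetric notion with `R_a` in place of `L_a`. -/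
structure IsRightAxis (d : F) (a : A) : Prop where
  d_ne_zero : d ≠ 0
  d_ne_one : d ≠ 1
  idem : a * a = a
  prim : rightEig F A a 1 = Submodule.span F {a}
  cube : ∀ v : A, v * a * a * a - v * a * a - d • (v * a * a) + d • (v * a) = 0
  decomp : rightEig F A a 0 ⊔ rightEig F A a 1 ⊔ rightEig F A a d = ⊤
  fusePP : ∀ x ∈ rightEig F A a 0 ⊔ rightEig F A a 1, ∀ y ∈ rightEig F A a 0 ⊔ rightEig F A a 1,
      x * y ∈ rightEig F A a 0 ⊔ rightEig F A a 1
  fusePM : ∀ x ∈ rightEig F A a 0 ⊔ rightEig F A a 1, ∀ y ∈ rightEig F A a d,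
      x * y ∈ rightEig F A a d
  fuseMP : ∀ x ∈ rightEig F A a d, ∀ y ∈ rightEig F A a 0 ⊔ rightEig F A a 1,
      x * y ∈ rightEig F A a d
  fuseMM : ∀ x ∈ rightEig F A a d, ∀ y ∈ rightEig F A a d,
      x * y ∈ rightEig F A a 0 ⊔ rightEig F A a 1

/-- `a` is a (two-sided) axis of type `(l, d)`. -/
structure IsAxis (l d : F) (a : A) : Prop where
  toLeft : IsLeftAxis F A l a
  toRight : IsRightAxis F A d a
  comm : ∀ v : A, a * (v * a) = (a * v) * a

/-- `a` is an axis of Jordan type `(l, d)`: an axis of type `(l, d)` with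
`A_{l,0}(a) = A_{0,d}(a) = 0`, so that `A = F·a ⊕ A_{0,0}(a) ⊕ A_{l,d}(a)`. -/
structure IsJordanAxis (l d : F) (a : A) extends IsAxis F A l d a : Prop where
  j_left : eig2 F A a l 0 = ⊥
  j_right : eig2 F A a 0 d = ⊥

section JordanAxis

variable {F A}

theorem mem_leftEig {a v : A} {l : F} : v ∈ leftEig F A a l ↔ a * v = l • v := Iff.rfl

theorem mem_rightEig {a v : A} {l : F} : v ∈ rightEig F A a l ↔ v * a = l • v := Iff.rfl

theorem IsLeftAxis.exists_eq_add {l : F} {a : A} (h : IsLeftAxis F A l a) (x : A) :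
    ∃ (t : F) (u v : A), x = t • a + u + v ∧ a * u = 0 ∧ a * v = l • v := by
  have hx : x ∈ leftEig F A a 0 ⊔ leftEig F A a 1 ⊔ leftEig F A a l := by
    rw [h.decomp]; trivial
  obtain ⟨w, hw, v, hv, rfl⟩ := Submodule.mem_sup.1 hx
  obtain ⟨u, hu, s, hs, rfl⟩ := Submodule.mem_sup.1 hw
  rw [h.prim] at hs
  obtain ⟨t, rfl⟩ := Submodule.mem_span_singleton.1 hs
  rw [mem_leftEig, zero_smul] at hu
  exact ⟨t, u, v, by abel, hu, hv⟩

theorem IsRightAxis.exists_eq_add {d : F} {a : A} (h : IsRightAxis F A d a) (x : A) :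
    ∃ (t : F) (u v : A), x = t • a + u + v ∧ u * a = 0 ∧ v * a = d • v := by
  have hx : x ∈ rightEig F A a 0 ⊔ rightEig F A a 1 ⊔ rightEig F A a d := by
    rw [h.decomp]; trivial
  obtain ⟨w, hw, v, hv, rfl⟩ := Submodule.mem_sup.1 hx
  obtain ⟨u, hu, s, hs, rfl⟩ := Submodule.mem_sup.1 hw
  rw [h.prim] at hs
  obtain ⟨t, rfl⟩ := Submodule.mem_span_singleton.1 hs
  rw [mem_rightEig, zero_smul] at hu
  exact ⟨t, u, v, by abel, hu, hv⟩

theorem IsLeftAxis.disjoint {l : F} {a : A} (h : IsLeftAxis F A l a) :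
    Disjoint (leftEig F A a 0 ⊔ leftEig F A a 1) (leftEig F A a l) := by
  rw [Submodule.disjoint_def]
  intro x hx hxl
  obtain ⟨u, hu, w, hw, rfl⟩ := Submodule.mem_sup.1 hx
  rw [mem_leftEig] at hu hw hxl
  rw [zero_smul] at hu
  rw [one_smul] at hw
  have hw' : w = l • (u + w) := by rw [← hxl, mul_add, hu, hw, zero_add]
  have hlw : w = l • w := by
    calc w = a * w := hw.symm
      _ = a * (l • (u + w)) := by rw [← hw']
      _ = l • w := by rw [mul_smul_comm, mul_add, hu, hw, zero_add]
  have hw0 : w = 0 := by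
    have : (1 - l) • w = 0 := by rw [sub_smul, one_smul, ← hlw, sub_self]
    exact (smul_eq_zero.1 this).resolve_left (sub_ne_zero.2 h.l_ne_one.symm)
  rw [hw0] at hw' ⊢
  exact (smul_eq_zero.1 hw'.symm).resolve_left h.l_ne_zero

theorem IsAxis.mul_mem_leftEig {l d k : F} {a v : A} (h : IsAxis F A l d a)
    (hv : v ∈ leftEig F A a k) : v * a ∈ leftEig F A a k := by
  rw [mem_leftEig] at *
  rw [h.comm, hv, smul_mul_assoc]

theorem IsAxis.smul_eq_zero_of_mem_leftEig {l d k s : F} {a : A} (h : IsAxis F A l d a)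
    (hk : k ≠ 1) (hs : s • a ∈ leftEig F A a k) : s • a = 0 := by
  rw [mem_leftEig, mul_smul_comm, h.toLeft.idem] at hs
  have : (1 - k) • s • a = 0 := by rw [sub_smul, one_smul, ← hs, sub_self]
  exact (smul_eq_zero.1 this).resolve_left (sub_ne_zero.2 hk.symm)

theorem IsJordanAxis.mul_eq_zero {l d : F} {a u : A} (h : IsJordanAxis F A l d a)
    (hu : a * u = 0) : u * a = 0 := by
  have hu0 : u ∈ leftEig F A a 0 := by rw [mem_leftEig, hu, zero_smul]
  obtain ⟨t, p, q, hx, hp, hq⟩ := h.toRight.exists_eq_add u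
  have e1 : u * a = t • a + d • q := by
    rw [hx, add_mul, add_mul, hp, hq, smul_mul_assoc, h.toLeft.idem, add_zero]
  have e2 : u * a * a = t • a + (d * d) • q := by
    rw [e1, add_mul, smul_mul_assoc, smul_mul_assoc, hq, h.toLeft.idem, smul_smul]
  have m1 := h.toIsAxis.mul_mem_leftEig hu0
  have m2 := h.toIsAxis.mul_mem_leftEig m1
  have hq0 : q = 0 := by
    have m3 := Submodule.sub_mem _ m2 m1
    have e3 : u * a * a - u * a = (d * (d - 1)) • q := by
      rw [e2, e1]; module
    rw [e3] at m3
    have hd : d * (d - 1) ≠ 0 :=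
      mul_ne_zero h.toRight.d_ne_zero (sub_ne_zero.2 h.toRight.d_ne_one)
    have m4 := (Submodule.smul_mem_iff _ hd).1 m3
    have m5 : q ∈ eig2 F A a 0 d := ⟨m4, hq⟩
    rwa [h.j_right, Submodule.mem_bot] at m5
  rw [e1, hq0, smul_zero, add_zero] at m1 ⊢
  exact h.toIsAxis.smul_eq_zero_of_mem_leftEig zero_ne_one m1

theorem IsJordanAxis.mul_eq_smul {l d : F} {a u : A} (h : IsJordanAxis F A l d a)
    (hu : a * u = l • u) : u * a = d • u := by
  have hul : u ∈ leftEig F A a l := hu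
  obtain ⟨t, p, q, hx, hp, hq⟩ := h.toRight.exists_eq_add u
  have e1 : u * a = t • a + d • q := by
    rw [hx, add_mul, add_mul, hp, hq, smul_mul_assoc, h.toLeft.idem, add_zero]
  have e2 : u * a * a = t • a + (d * d) • q := by
    rw [e1, add_mul, smul_mul_assoc, smul_mul_assoc, hq, h.toLeft.idem, smul_smul]
  have m1 := h.toIsAxis.mul_mem_leftEig hul
  have m2 := h.toIsAxis.mul_mem_leftEig m1
  have hp0 : p = 0 := by
    have m3 := Submodule.add_mem _ (Submodule.sub_mem _ m2 (Submodule.smul_mem _ (1 + d) m1))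
      (Submodule.smul_mem _ d hul)
    have e3 : u * a * a - (1 + d) • (u * a) + d • u = d • p := by
      rw [e2, e1, hx]; module
    rw [e3] at m3
    have m4 := (Submodule.smul_mem_iff _ h.toRight.d_ne_zero).1 m3
    have m5 : p ∈ eig2 F A a l 0 := ⟨m4, mem_rightEig.2 (by rw [hp, zero_smul])⟩
    rwa [h.j_left, Submodule.mem_bot] at m5
  have m6 : t • a ∈ leftEig F A a l := by
    have m7 := Submodule.sub_mem _ m1 (Submodule.smul_mem _ d hul)
    have e4 : u * a - d • u = (1 - d) • t • a := by
      rw [e1, hx, hp0]; module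
    rw [e4] at m7
    exact (Submodule.smul_mem_iff _ (sub_ne_zero.2 h.toRight.d_ne_one.symm)).1 m7
  have h0 := h.toIsAxis.smul_eq_zero_of_mem_leftEig h.toLeft.l_ne_one m6
  rw [e1, hx, hp0, h0, zero_add, zero_add, zero_add]

/-- The Miyamoto involution of an axis sends idempotents to idempotents. -/
theorem IsLeftAxis.sub_mul_self {l : F} {a p q : A} (h : IsLeftAxis F A l a)
    (hp : p ∈ leftEig F A a 0 ⊔ leftEig F A a 1) (hq : q ∈ leftEig F A a l)
    (hi : (p + q) * (p + q) = p + q) : (p - q) * (p - q) = p - q := by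
  have hodd := Submodule.sub_mem _ hq
    (Submodule.add_mem _ (h.fusePM p hp q hq) (h.fuseMP q hq p hp))
  have heven := Submodule.sub_mem _
    (Submodule.add_mem _ (h.fusePP p hp p hp) (h.fuseMM q hq q hq)) hp
  have key : p * p + q * q - p = q - (p * q + q * p) := by
    rw [sub_eq_sub_iff_add_eq_add, add_comm q p, ← hi]
    simp only [add_mul, mul_add]
    abel
  rw [← key] at hodd
  have h1 := Submodule.disjoint_def.1 h.disjoint _ heven hodd
  have h2 := h1
  rw [key] at h2
  have : (p - q) * (p - q) = (p * p + q * q - p) + (q - (p * q + q * p)) + (p - q) := by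
    simp only [sub_mul, mul_sub]
    abel
  rw [this, h1, h2, add_zero, zero_add]

theorem IsJordanAxis.exists_eq_add {l d : F} {a : A} (h : IsJordanAxis F A l d a) (x : A) :
    ∃ (t : F) (u v : A), x = t • a + u + v ∧ a * u = 0 ∧ a * v = l • v ∧
      a * x = t • a + l • v ∧ x * a = t • a + d • v ∧ v * a = d • v := by
  obtain ⟨t, u, v, hx, hu, hv⟩ := h.toLeft.exists_eq_add x
  refine ⟨t, u, v, hx, hu, hv, ?_, ?_, h.mul_eq_smul hv⟩
  · rw [hx, mul_add, mul_add, hu, hv, mul_smul_comm, h.toLeft.idem, add_zero]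
  · rw [hx, add_mul, add_mul, h.mul_eq_zero hu, h.mul_eq_smul hv, smul_mul_assoc,
      h.toLeft.idem, add_zero]

theorem IsJordanAxis.odd_mem_span {l d t : F} {a b v : A} (h : IsJordanAxis F A l d a)
    (hab : a * b = t • a + l • v) : v ∈ Submodule.span F {a, b, a * b} := by
  refine (Submodule.smul_mem_iff _ h.toLeft.l_ne_zero).1 ?_
  rw [show l • v = a * b - t • a by rw [hab, add_sub_cancel_left]]
  exact Submodule.sub_mem _ (Submodule.subset_span (by simp))
    (Submodule.smul_mem _ _ (Submodule.subset_span (by simp)))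

theorem IsJordanAxis.mul_comm_mem_span {l d : F} {a : A} (h : IsJordanAxis F A l d a) (b : A) :
    b * a ∈ Submodule.span F {a, b, a * b} := by
  obtain ⟨t, u, v, -, -, -, hab, hba, -⟩ := h.exists_eq_add b
  rw [hba]
  exact Submodule.add_mem _ (Submodule.smul_mem _ _ (Submodule.subset_span (by simp)))
    (Submodule.smul_mem _ _ (h.odd_mem_span hab))

theorem IsJordanAxis.mul_mem_span {l d : F} {a b y : A} (h : IsJordanAxis F A l d a)
    (hy : y ∈ Submodule.span F {a, b, a * b}) :
    a * y ∈ Submodule.span F {a, b, a * b} ∧ y * a ∈ Submodule.span F {a, b, a * b} := by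
  obtain ⟨t, u, v, -, -, hav, hab, -, hva⟩ := h.exists_eq_add b
  have ma : a ∈ Submodule.span F {a, b, a * b} := Submodule.subset_span (by simp)
  have mv := h.odd_mem_span hab
  induction hy using Submodule.span_induction with
  | mem x hx =>
    rcases hx with rfl | rfl | rfl
    · rw [h.toLeft.idem]; exact ⟨ma, ma⟩
    · exact ⟨Submodule.subset_span (by simp), h.mul_comm_mem_span _⟩
    · have e1 : a * (a * b) = t • a + l • l • v := by
        rw [hab, mul_add, mul_smul_comm, mul_smul_comm, hav, h.toLeft.idem]
      have e2 : a * b * a = t • a + l • d • v := by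
        rw [hab, add_mul, smul_mul_assoc, smul_mul_assoc, hva, h.toLeft.idem]
      rw [e1, e2]
      exact ⟨Submodule.add_mem _ (Submodule.smul_mem _ _ ma)
          (Submodule.smul_mem _ _ (Submodule.smul_mem _ _ mv)),
        Submodule.add_mem _ (Submodule.smul_mem _ _ ma)
          (Submodule.smul_mem _ _ (Submodule.smul_mem _ _ mv))⟩
  | zero => simp
  | add x y _ _ hx hy =>
    rw [mul_add, add_mul]
    exact ⟨Submodule.add_mem _ hx.1 hy.1, Submodule.add_mem _ hx.2 hy.2⟩
  | smul c x _ hx =>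
    rw [mul_smul_comm, smul_mul_assoc]
    exact ⟨Submodule.smul_mem _ _ hx.1, Submodule.smul_mem _ _ hx.2⟩

theorem IsJordanAxis.span_comm {l d l' d' : F} {a b : A} (ha : IsJordanAxis F A l d a)
    (hb : IsJordanAxis F A l' d' b) :
    Submodule.span F {a, b, a * b} = Submodule.span F {b, a, b * a} := by
  apply le_antisymm <;> rw [Submodule.span_le] <;> rintro x (rfl | rfl | rfl)
  · exact Submodule.subset_span (by simp)
  · exact Submodule.subset_span (by simp)
  · exact hb.mul_comm_mem_span _
  · exact Submodule.subset_span (by simp)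
  · exact Submodule.subset_span (by simp)
  · exact ha.mul_comm_mem_span _

/-- If `b` is idempotent, then `span {a, b, a * b}` is also spanned by `a`, `b` and the
idempotent image of `b` under the Miyamoto involution of `a`. -/
theorem IsJordanAxis.exists_idempotent_span_eq {l d : F} {a b : A} (h2 : (2 : F) ≠ 0)
    (h : IsJordanAxis F A l d a) (hb : b * b = b) :
    ∃ c : A, c * c = c ∧ Submodule.span F {a, b, a * b} = Submodule.span F {a, b, c} := by
  obtain ⟨t, u, v, hx, hu, hv, hab, -, -⟩ := h.exists_eq_add b
  have hp : t • a + u ∈ leftEig F A a 0 ⊔ leftEig F A a 1 := by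
    rw [add_comm]
    refine Submodule.add_mem_sup ?_ (Submodule.smul_mem _ _ ?_)
    · rw [mem_leftEig, hu, zero_smul]
    · rw [mem_leftEig, one_smul, h.toLeft.idem]
  have hc : t • a + u - v = b - (2 : F) • v := by rw [hx, two_smul]; abel
  refine ⟨t • a + u - v, h.toLeft.sub_mul_self hp hv (by rw [← hx, hb]), ?_⟩
  rw [hc]
  have mv : v ∈ Submodule.span F {a, b, b - (2 : F) • v} := by
    refine (Submodule.smul_mem_iff _ h2).1 ?_
    rw [show (2 : F) • v = b - (b - (2 : F) • v) by abel]
    exact Submodule.sub_mem _ (Submodule.subset_span (by simp)) (Submodule.subset_span (by simp))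
  apply le_antisymm <;> rw [Submodule.span_le] <;> rintro x (rfl | rfl | rfl)
  · exact Submodule.subset_span (by simp)
  · exact Submodule.subset_span (by simp)
  · rw [hab]
    exact Submodule.add_mem _ (Submodule.smul_mem _ _ (Submodule.subset_span (by simp)))
      (Submodule.smul_mem _ _ mv)
  · exact Submodule.subset_span (by simp)
  · exact Submodule.subset_span (by simp)
  · exact Submodule.sub_mem _ (Submodule.subset_span (by simp))
      (Submodule.smul_mem _ _ (h.odd_mem_span hab))

theorem IsJordanAxis.mul_mem_span_of_mem {l d l' d' : F} {a b : A} (h2 : (2 : F) ≠ 0)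
    (ha : IsJordanAxis F A l d a) (hb : IsJordanAxis F A l' d' b) {x y : A}
    (hx : x ∈ Submodule.span F {a, b, a * b}) (hy : y ∈ Submodule.span F {a, b, a * b}) :
    x * y ∈ Submodule.span F {a, b, a * b} := by
  obtain ⟨c, hc, hspan⟩ := ha.exists_idempotent_span_eq h2 hb.toLeft.idem
  have mc : c ∈ Submodule.span F {a, b, a * b} := by
    rw [hspan]; exact Submodule.subset_span (by simp)
  have Ha := fun z hz => ha.mul_mem_span (b := b) (y := z) hz
  have Hb := fun z hz => hb.mul_mem_span (b := a) (y := z) hz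
  rw [← ha.span_comm hb] at Hb
  have hxy : ∀ z w : A, z ∈ ({a, b, c} : Set A) → w ∈ ({a, b, c} : Set A) →
      z * w ∈ Submodule.span F {a, b, a * b} := by
    intro z w hz hw
    have mw : w ∈ Submodule.span F {a, b, a * b} := by
      rw [hspan]; exact Submodule.subset_span hw
    rcases hz with rfl | rfl | rfl
    · exact (Ha w mw).1
    · exact (Hb w mw).1
    · rcases hw with rfl | rfl | rfl
      · exact (Ha _ mc).2
      · exact (Hb _ mc).2
      · rwa [hc]
  rw [hspan] at hx hy
  induction hx, hy using Submodule.span_induction₂ with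
  | mem_mem z w hz hw => exact hxy z w hz hw
  | zero_left => simp
  | zero_right => simp
  | add_left _ _ _ _ _ _ h1 h2 => rw [add_mul]; exact Submodule.add_mem _ h1 h2
  | add_right _ _ _ _ _ _ h1 h2 => rw [mul_add]; exact Submodule.add_mem _ h1 h2
  | smul_left _ _ _ _ _ h => rw [smul_mul_assoc]; exact Submodule.smul_mem _ _ h
  | smul_right _ _ _ _ _ h => rw [mul_smul_comm]; exact Submodule.smul_mem _ _ h

end JordanAxis

/-- if `A` is generated by Jordan axes `a, b`, then `A` is spanned by
`a`, `b`, `a*b`; in particular `dim_F A ≤ 3`. -/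
theorem spanned_by_a_b_ab (hchar : (2 : F) ≠ 0) (l d l' d' : F) (a b : A)
    (ha : IsJordanAxis F A l d a) (hb : IsJordanAxis F A l' d' b)
    (hgen : NonUnitalAlgebra.adjoin F {a, b} = ⊤) :
    Submodule.span F {a, b, a * b} = ⊤ ∧ Module.finrank F A ≤ 3 := by
  have hspan : Submodule.span F {a, b, a * b} = ⊤ := by
    rw [eq_top_iff]
    intro x _
    have hx : x ∈ NonUnitalAlgebra.adjoin F {a, b} := by rw [hgen]; trivial
    induction hx using NonUnitalAlgebra.adjoin_induction with
    | mem x hx => exact Submodule.subset_span (by rcases hx with rfl | rfl <;> simp)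
    | add x y _ _ hx hy => exact Submodule.add_mem _ (hx trivial) (hy trivial)
    | zero => exact Submodule.zero_mem _
    | mul x y _ _ hx hy => exact ha.mul_mem_span_of_mem hchar hb (hx trivial) (hy trivial)
    | smul c x _ hx => exact Submodule.smul_mem _ _ (hx trivial)
  refine ⟨hspan, ?_⟩
  classical
  have hcard := finrank_span_finset_le_card (R := F) ({a, b, a * b} : Finset A)
  rw [Finset.coe_insert, Finset.coe_insert, Finset.coe_singleton, Set.finrank, hspan,
    finrank_top] at hcard
  exact hcard.trans Finset.card_le_three
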